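/- Let 𝒯 be a finite set of trajectories with at least two elements and G : 𝒯 → ℝ a return function, and let trajectory preference probabilities be P*(τ₁ ≻ τ₂) = σ(β(G(τ₁) − G(τ₂))). Then the trajectory preference loss L_traj(π) = −(1/|𝒯|²) · Σ_{(τ₁,τ₂)∈𝒯×𝒯} P*(τ₁ ≻ τ₂) · log σ(α(log π(τ₁) − log π(τ₂))) is uniquely minimized over full-support probability distributions π on 𝒯 by the Gibbs distribution π*(τ) = exp((β/α)·G(τ)) / Σ_{τ'} exp((β/α)·G(τ')): for every full-support probability distribution π ≠ π*, L_traj(π) > L_traj(π*). -/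

import Mathlib

open Finset

/-- The logistic (sigmoid) function σ(z) = 1/(1+e^{-z}). -/
noncomputable def sigmoid (z : ℝ) : ℝ := 1 / (1 + Real.exp (-z))

/-- Trajectory preference loss
L_traj(π) = −(1/|𝒯|²) · Σ_{(τ₁,τ₂)} σ(β(G τ₁ − G τ₂)) · log σ(α(log π τ₁ − log π τ₂)). -/
noncomputable def trajLoss {T : Type*} [Fintype T] (α β : ℝ) (G : T → ℝ) (π : T → ℝ) : ℝ :=
  -(1 / ((Fintype.card T : ℝ) ^ 2)) *
    ∑ τ₁ : T, ∑ τ₂ : T,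
      sigmoid (β * (G τ₁ - G τ₂)) * Real.log (sigmoid (α * (Real.log (π τ₁) - Real.log (π τ₂))))

theorem sigmoid_pos (z : ℝ) : 0 < sigmoid z := by
  unfold sigmoid
  positivity

theorem sigmoid_add_sigmoid_neg (z : ℝ) : sigmoid z + sigmoid (-z) = 1 := by
  unfold sigmoid
  rw [neg_neg, Real.exp_neg]
  have := Real.exp_pos z
  field_simp
  ring

theorem sigmoid_injective : Function.Injective sigmoid := by
  intro a b h
  unfold sigmoid at h
  have h1 : 1 + Real.exp (-a) = 1 + Real.exp (-b) := by simpa using h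
  simpa using h1

theorem mul_log_lt_mul_log_add_sub {p q : ℝ} (hp : 0 < p) (hq : 0 < q) (h : q ≠ p) :
    p * Real.log q < p * Real.log p + (q - p) := by
  have h1 := Real.log_lt_sub_one_of_pos (div_pos hq hp) (by rwa [Ne, div_eq_one_iff_eq hp.ne'])
  rw [Real.log_div hq.ne' hp.ne'] at h1
  have h2 := mul_lt_mul_of_pos_left h1 hp
  have h3 : p * (q / p - 1) = q - p := by field_simp
  linarith

/-- The total of pairwise sigmoid probabilities does not depend on the scores. -/
theorem sum_sigmoid_sub {T : Type*} [Fintype T] (c : ℝ) (f : T → ℝ) :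
    ∑ x : T × T, sigmoid (c * (f x.1 - f x.2)) = (Fintype.card (T × T) : ℝ) / 2 := by
  have h : ∑ x : T × T, sigmoid (c * (f x.1 - f x.2)) =
      ∑ x : T × T, sigmoid (-(c * (f x.1 - f x.2))) := by
    refine Fintype.sum_equiv (Equiv.prodComm T T) _ _ fun x => ?_
    congr 1
    simp only [Equiv.prodComm_apply, Prod.fst_swap, Prod.snd_swap]
    ring
  have h2 : ∑ x : T × T, sigmoid (c * (f x.1 - f x.2)) +
      ∑ x : T × T, sigmoid (-(c * (f x.1 - f x.2))) = (Fintype.card (T × T) : ℝ) := by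
    rw [← Finset.sum_add_distrib]
    simp [sigmoid_add_sigmoid_neg]
  linarith

/-- A probability distribution whose log-ratios are differences of `f` is the Gibbs
distribution of `f`. -/
theorem eq_gibbs_of_log_sub_log {T : Type*} [Fintype T] {f π : T → ℝ} (hpos : ∀ τ, 0 < π τ)
    (hsum : ∑ τ, π τ = 1)
    (h : ∀ τ₁ τ₂, Real.log (π τ₁) - Real.log (π τ₂) = f τ₁ - f τ₂) :
    π = fun τ => Real.exp (f τ) / ∑ τ', Real.exp (f τ') := by
  funext τ
  have hmul : ∀ τ', π τ * Real.exp (f τ') = Real.exp (f τ) * π τ' := by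
    intro τ'
    rw [← Real.exp_log (hpos τ), ← Real.exp_log (hpos τ'), ← Real.exp_add, ← Real.exp_add]
    congr 1
    linarith [h τ τ']
  have hZ : 0 < ∑ τ', Real.exp (f τ') :=
    Finset.sum_pos (fun _ _ => Real.exp_pos _) ⟨τ, Finset.mem_univ τ⟩
  rw [eq_div_iff hZ.ne', Finset.mul_sum, Finset.sum_congr rfl fun τ' _ => hmul τ',
    ← Finset.mul_sum, hsum, mul_one]

/-- the trajectory preference loss is uniquely minimized over full-support
probability distributions on 𝒯 by the Gibbs distribution
π*(τ) = exp((β/α)·G(τ))/Σ_{τ'} exp((β/α)·G(τ')). -/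
theorem stmt_13 {T : Type*} [Fintype T] (hT : 2 ≤ Fintype.card T)
    (G : T → ℝ) (α β : ℝ) (hα : 0 < α) (hβ : 0 < β)
    (πStar : T → ℝ)
    (hπStar : πStar = fun τ => Real.exp ((β / α) * G τ) / ∑ τ' : T, Real.exp ((β / α) * G τ')) :
    ∀ π : T → ℝ, (∀ τ, 0 < π τ) → (∑ τ : T, π τ = 1) → π ≠ πStar →
      trajLoss α β G πStar < trajLoss α β G π := by
  intro π hpos hsum hne
  have : Nonempty T := Fintype.card_pos_iff.mp (by omega)
  have hZ : 0 < ∑ τ' : T, Real.exp ((β / α) * G τ') :=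
    Finset.sum_pos (fun _ _ => Real.exp_pos _) Finset.univ_nonempty
  have hstar : ∀ τ₁ τ₂, α * (Real.log (πStar τ₁) - Real.log (πStar τ₂)) = β * (G τ₁ - G τ₂) := by
    intro τ₁ τ₂
    simp only [hπStar]
    rw [Real.log_div (Real.exp_pos _).ne' hZ.ne', Real.log_div (Real.exp_pos _).ne' hZ.ne',
      Real.log_exp, Real.log_exp]
    field_simp
    ring
  obtain ⟨τ₁, τ₂, hdiff⟩ : ∃ τ₁ τ₂,
      α * (Real.log (π τ₁) - Real.log (π τ₂)) ≠ β * (G τ₁ - G τ₂) := by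
    by_contra! hall
    refine hne ((eq_gibbs_of_log_sub_log hpos hsum fun τ₁ τ₂ => ?_).trans hπStar.symm)
    have h := hall τ₁ τ₂
    field_simp
    linarith
  have hlt : ∑ x : T × T, sigmoid (β * (G x.1 - G x.2)) *
        Real.log (sigmoid (α * (Real.log (π x.1) - Real.log (π x.2)))) <
      ∑ x : T × T, (sigmoid (β * (G x.1 - G x.2)) * Real.log (sigmoid (β * (G x.1 - G x.2))) +
        (sigmoid (α * (Real.log (π x.1) - Real.log (π x.2))) -
          sigmoid (β * (G x.1 - G x.2)))) := by
    refine Finset.sum_lt_sum (fun x _ => ?_) ⟨(τ₁, τ₂), Finset.mem_univ _,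
      mul_log_lt_mul_log_add_sub (sigmoid_pos _) (sigmoid_pos _) (sigmoid_injective.ne hdiff)⟩
    by_cases h : sigmoid (α * (Real.log (π x.1) - Real.log (π x.2))) =
        sigmoid (β * (G x.1 - G x.2))
    · simp [h]
    · exact (mul_log_lt_mul_log_add_sub (sigmoid_pos _) (sigmoid_pos _) h).le
  rw [Finset.sum_add_distrib, Finset.sum_sub_distrib, sum_sigmoid_sub β G,
    sum_sigmoid_sub α fun τ => Real.log (π τ), sub_self, add_zero, Fintype.sum_prod_type,
    Fintype.sum_prod_type] at hlt
  have hcard : (0 : ℝ) < 1 / (Fintype.card T : ℝ) ^ 2 := by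
    have : (0 : ℝ) < Fintype.card T := by exact_mod_cast Fintype.card_pos
    positivity
  unfold trajLoss
  simp only [hstar]
  exact mul_lt_mul_of_neg_left hlt (neg_lt_zero.mpr hcard)
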